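/- arXiv:1507.00698 — 2 statements merged into one kernel-verified Lean document; each statement's English description precedes it below -/
import Mathlib

section
/- For every point (x,y) ∈ ℝ² with f_k(x,y) = 0 one has P_T(x,y) = −τ_k B(x,y) μ_k(x,y) ∂f_k/∂y(x,y) and Q_T(x,y) = τ_k B(x,y) μ_k(x,y) ∂f_k/∂x(x,y); consequently the vector field X_T vanishes at no point of the circle C_k. -/
open MvPolynomial Function Set Filter Real
open scoped Classical

noncomputable section

/-- Bivariate real polynomials, representing components of planar polynomial vector fields. -/
abbrev Poly2 := MvPolynomial (Fin 2) ℝ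

/-- Evaluation of a bivariate polynomial at a point of the plane. -/
def pev (P : Poly2) (p : ℝ × ℝ) : ℝ := MvPolynomial.eval ![p.1, p.2] P

/-- The circle polynomial `f(x,y) = (x−a)² + (y−b)² − ρ²`. -/
def fpoly (c : ℝ × ℝ) (ρ : ℝ) : Poly2 :=
  (X 0 - MvPolynomial.C c.1) ^ 2 + (X 1 - MvPolynomial.C c.2) ^ 2 - MvPolynomial.C (ρ ^ 2)

/-- The divergence `∂P/∂x + ∂Q/∂y` of the vector field `X = P ∂ₓ + Q ∂ᵧ`. -/
def divPoly (P Q : Poly2) : Poly2 := pderiv 0 P + pderiv 1 Q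

/-- `γ : ℝ → ℝ²` is a (C¹) solution of the vector field `X = P ∂ₓ + Q ∂ᵧ`. -/
def IsSolution (P Q : Poly2) (γ : ℝ → ℝ × ℝ) : Prop :=
  ∀ t, HasDerivAt γ (pev P (γ t), pev Q (γ t)) t

/-- `S` is a periodic orbit of `X = P ∂ₓ + Q ∂ᵧ`: the image of a nonconstant periodic solution. -/
def IsPeriodicOrbit (P Q : Poly2) (S : Set (ℝ × ℝ)) : Prop :=
  ∃ γ : ℝ → ℝ × ℝ, ∃ T : ℝ, 0 < T ∧ IsSolution P Q γ ∧ Function.Periodic γ T ∧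
    (∃ t₀ t₁, γ t₀ ≠ γ t₁) ∧ Set.range γ = S

/-- `S` is a limit cycle: a periodic orbit with a neighborhood meeting no other periodic orbit. -/
def IsLimitCycle (P Q : Poly2) (S : Set (ℝ × ℝ)) : Prop :=
  IsPeriodicOrbit P Q S ∧
  ∃ U : Set (ℝ × ℝ), IsOpen U ∧ S ⊆ U ∧
    ∀ S', IsPeriodicOrbit P Q S' → S' ≠ S → Disjoint S' U

/-- `T` is the least positive period of `γ`. -/
def IsLeastPeriod (γ : ℝ → ℝ × ℝ) (T : ℝ) : Prop :=
  0 < T ∧ Function.Periodic γ T ∧ ∀ T', 0 < T' → Function.Periodic γ T' → T ≤ T'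

/-- The (limit) cycle `S` has least period `T`: it is parametrized by a solution of least
period `T`. -/
def HasLeastPeriodCycle (P Q : Poly2) (S : Set (ℝ × ℝ)) (T : ℝ) : Prop :=
  ∃ γ : ℝ → ℝ × ℝ, IsSolution P Q γ ∧ Set.range γ = S ∧ IsLeastPeriod γ T

/-- `V` is a (polynomial) inverse integrating factor of `X = P ∂ₓ + Q ∂ᵧ`:
`P ∂V/∂x + Q ∂V/∂y = V (∂P/∂x + ∂Q/∂y)`. -/
def IsInvFactor (P Q V : Poly2) : Prop :=
  P * pderiv 0 V + Q * pderiv 1 V = V * divPoly P Q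

/-- An embedded closed curve in the plane: a set homeomorphic to the circle. -/
def IsCycle (S : Set (ℝ × ℝ)) : Prop :=
  Nonempty (S ≃ₜ Metric.sphere (0 : ℝ × ℝ) 1)

/-- The compact region `D_C` bounded by a closed curve `C`: the curve together with the
points of the complement whose connected component in the complement is bounded. -/
def encDisk (S : Set (ℝ × ℝ)) : Set (ℝ × ℝ) :=
  S ∪ {p | p ∉ S ∧ Bornology.IsBounded (connectedComponentIn Sᶜ p)}

/-- `C_k` is a primary cycle of the configuration `Γ`: no other `C_j` is contained in `D_{C_k}`. -/
def PrimaryCycle {n : ℕ} (Γ : Fin n → Set (ℝ × ℝ)) (k : Fin n) : Prop :=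
  ∀ j, j ≠ k → ¬ Γ j ⊆ encDisk (Γ k)

/-- The limit cycle `S`, with enclosed region `D`, is stable in the interior for
`X = P ∂ₓ + Q ∂ᵧ`: every solution starting in the bounded region enclosed by `S`
sufficiently close to `S` converges to `S` as `t → +∞`. -/
def InteriorStable (P Q : Poly2) (S D : Set (ℝ × ℝ)) : Prop :=
  ∃ U : Set (ℝ × ℝ), IsOpen U ∧ S ⊆ U ∧
    ∀ γ : ℝ → ℝ × ℝ, IsSolution P Q γ → γ 0 ∈ (D \ S) ∩ U →
      Filter.Tendsto (fun t => Metric.infDist (γ t) S) Filter.atTop (nhds 0)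

/-- The limit cycle `S`, with enclosed region `D`, is unstable in the interior:
every solution starting in the bounded region enclosed by `S` sufficiently close to `S`
converges to `S` as `t → −∞`. -/
def InteriorUnstable (P Q : Poly2) (S D : Set (ℝ × ℝ)) : Prop :=
  ∃ U : Set (ℝ × ℝ), IsOpen U ∧ S ⊆ U ∧
    ∀ γ : ℝ → ℝ × ℝ, IsSolution P Q γ → γ 0 ∈ (D \ S) ∩ U →
      Filter.Tendsto (fun t => Metric.infDist (γ t) S) Filter.atBot (nhds 0)

/-- The polynomial `g(x,y) = (x−a)² + (y−b)²`. -/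
def gpoly (c : ℝ × ℝ) : Poly2 :=
  (X 0 - MvPolynomial.C c.1) ^ 2 + (X 1 - MvPolynomial.C c.2) ^ 2

variable {n : ℕ}

/-- `f_k(x,y) = (x−x_k)² + (y−y_k)² − r_k²`. -/
def fk (ctr : Fin n → ℝ × ℝ) (rad : Fin n → ℝ) (k : Fin n) : Poly2 :=
  fpoly (ctr k) (rad k)

/-- The circle `C_k = f_k⁻¹(0)`. -/
def Ccir (ctr : Fin n → ℝ × ℝ) (rad : Fin n → ℝ) (k : Fin n) : Set (ℝ × ℝ) :=
  {p : ℝ × ℝ | pev (fk ctr rad k) p = 0}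

/-- The closed disc `D_{C_k}` bounded by the circle `C_k`. -/
def Ddisc (ctr : Fin n → ℝ × ℝ) (rad : Fin n → ℝ) (k : Fin n) : Set (ℝ × ℝ) :=
  {p : ℝ × ℝ | (p.1 - (ctr k).1) ^ 2 + (p.2 - (ctr k).2) ^ 2 ≤ (rad k) ^ 2}

/-- `C_k` is primary: no other circle `C_j` is contained in `D_{C_k}`. -/
def Primary (ctr : Fin n → ℝ × ℝ) (rad : Fin n → ℝ) (k : Fin n) : Prop :=
  ∀ j, j ≠ k → ¬ Ccir ctr rad j ⊆ Ddisc ctr rad k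

/-- `A = ∏_{k=1}^n f_k`. -/
def Apoly (ctr : Fin n → ℝ × ℝ) (rad : Fin n → ℝ) : Poly2 := ∏ k, fk ctr rad k

/-- `B = ∏_{k=1}^r g_k` (product over the primary indices, i.e. those with `k < r`). -/
def Bpoly (r : ℕ) (ctr : Fin n → ℝ × ℝ) : Poly2 :=
  ∏ k ∈ Finset.univ.filter (fun k : Fin n => (k : ℕ) < r), gpoly (ctr k)

/-- `μ_k = ∏_{j≠k} f_j`. -/
def muk (ctr : Fin n → ℝ × ℝ) (rad : Fin n → ℝ) (k : Fin n) : Poly2 :=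
  ∏ j ∈ Finset.univ.erase k, fk ctr rad j

/-- `P_T = A(∂B/∂x − ∂B/∂y) − B Σ_k τ_k μ_k ∂f_k/∂y`. -/
def PT (r : ℕ) (ctr : Fin n → ℝ × ℝ) (rad τ : Fin n → ℝ) : Poly2 :=
  Apoly ctr rad * (pderiv 0 (Bpoly r ctr) - pderiv 1 (Bpoly r ctr)) -
    Bpoly r ctr * ∑ k, MvPolynomial.C (τ k) * muk ctr rad k * pderiv 1 (fk ctr rad k)

/-- `Q_T = A(∂B/∂x + ∂B/∂y) + B Σ_k τ_k μ_k ∂f_k/∂x`. -/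
def QT (r : ℕ) (ctr : Fin n → ℝ × ℝ) (rad τ : Fin n → ℝ) : Poly2 :=
  Apoly ctr rad * (pderiv 0 (Bpoly r ctr) + pderiv 1 (Bpoly r ctr)) +
    Bpoly r ctr * ∑ k, MvPolynomial.C (τ k) * muk ctr rad k * pderiv 0 (fk ctr rad k)

/-- `N_k`: the number of circles `C_j`, `j ≠ k`, whose bounded disc contains `C_k`. -/
def Nk (ctr : Fin n → ℝ × ℝ) (rad : Fin n → ℝ) (k : Fin n) : ℕ :=
  Nat.card {j : Fin n // j ≠ k ∧ Ccir ctr rad k ⊆ Ddisc ctr rad j}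

/-- `s_k`: the number of primary circles contained in the closed disc `D_{C_k}`. -/
def sk (r : ℕ) (ctr : Fin n → ℝ × ℝ) (rad : Fin n → ℝ) (k : Fin n) : ℕ :=
  Nat.card {j : Fin n // (j : ℕ) < r ∧ Ccir ctr rad j ⊆ Ddisc ctr rad k}

lemma pev_eq_eval (P : Poly2) (p : ℝ × ℝ) : pev P p = MvPolynomial.eval ![p.1, p.2] P := rfl

lemma pev_fk (ctr : Fin n → ℝ × ℝ) (rad : Fin n → ℝ) (k : Fin n) (p : ℝ × ℝ) :
    pev (fk ctr rad k) p =
      (p.1 - (ctr k).1) ^ 2 + (p.2 - (ctr k).2) ^ 2 - rad k ^ 2 := by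
  simp [pev, fk, fpoly]

lemma pev_gpoly (c p : ℝ × ℝ) :
    pev (gpoly c) p = (p.1 - c.1) ^ 2 + (p.2 - c.2) ^ 2 := by
  simp [pev, gpoly]

lemma pev_pderiv_zero_fk (ctr : Fin n → ℝ × ℝ) (rad : Fin n → ℝ) (k : Fin n) (p : ℝ × ℝ) :
    pev (pderiv 0 (fk ctr rad k)) p = 2 * (p.1 - (ctr k).1) := by
  simp [pev, fk, fpoly, pderiv_X, Derivation.leibniz_pow, -map_pow]

lemma pev_pderiv_one_fk (ctr : Fin n → ℝ × ℝ) (rad : Fin n → ℝ) (k : Fin n) (p : ℝ × ℝ) :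
    pev (pderiv 1 (fk ctr rad k)) p = 2 * (p.2 - (ctr k).2) := by
  simp [pev, fk, fpoly, pderiv_X, Derivation.leibniz_pow, -map_pow]

lemma pev_Apoly_eq_zero (ctr : Fin n → ℝ × ℝ) (rad : Fin n → ℝ) {k : Fin n} {p : ℝ × ℝ}
    (hp : pev (fk ctr rad k) p = 0) : pev (Apoly ctr rad) p = 0 := by
  rw [pev, Apoly, map_prod]
  exact Finset.prod_eq_zero (Finset.mem_univ k) hp

lemma pev_muk_eq_zero (ctr : Fin n → ℝ × ℝ) (rad : Fin n → ℝ) {j k : Fin n} (hjk : j ≠ k)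
    {p : ℝ × ℝ} (hp : pev (fk ctr rad k) p = 0) : pev (muk ctr rad j) p = 0 := by
  rw [pev, muk, map_prod]
  exact Finset.prod_eq_zero (Finset.mem_erase.2 ⟨hjk.symm, Finset.mem_univ k⟩) hp

/-- On `C_k` only the `k`-th term of `∑ j, τ_j μ_j h_j` survives. -/
lemma pev_sum_muk (ctr : Fin n → ℝ × ℝ) (rad τ : Fin n → ℝ) (h : Fin n → Poly2) {k : Fin n}
    {p : ℝ × ℝ} (hp : pev (fk ctr rad k) p = 0) :
    pev (∑ j, MvPolynomial.C (τ j) * muk ctr rad j * h j) p =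
      τ k * pev (muk ctr rad k) p * pev (h k) p := by
  rw [pev, map_sum, Finset.sum_eq_single k]
  · simp [pev]
  · intro j _ hjk
    have := pev_muk_eq_zero ctr rad hjk hp
    rw [pev] at this
    simp [this]
  · simp

lemma pev_PT_on_circle (r : ℕ) (ctr : Fin n → ℝ × ℝ) (rad τ : Fin n → ℝ) {k : Fin n}
    {p : ℝ × ℝ} (hp : pev (fk ctr rad k) p = 0) :
    pev (PT r ctr rad τ) p = -(τ k) * pev (Bpoly r ctr) p * pev (muk ctr rad k) p *
      pev (pderiv 1 (fk ctr rad k)) p := by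
  have hA := pev_Apoly_eq_zero ctr rad hp
  have hS := pev_sum_muk ctr rad τ (fun j => pderiv 1 (fk ctr rad j)) hp
  simp only [pev] at hA hS ⊢
  rw [PT, map_sub, map_mul, map_mul, hA, hS]
  ring

lemma pev_QT_on_circle (r : ℕ) (ctr : Fin n → ℝ × ℝ) (rad τ : Fin n → ℝ) {k : Fin n}
    {p : ℝ × ℝ} (hp : pev (fk ctr rad k) p = 0) :
    pev (QT r ctr rad τ) p = τ k * pev (Bpoly r ctr) p * pev (muk ctr rad k) p *
      pev (pderiv 0 (fk ctr rad k)) p := by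
  have hA := pev_Apoly_eq_zero ctr rad hp
  have hS := pev_sum_muk ctr rad τ (fun j => pderiv 0 (fk ctr rad j)) hp
  simp only [pev] at hA hS ⊢
  rw [QT, map_add, map_mul, map_mul, hA, hS]
  ring

lemma pev_muk_ne_zero (ctr : Fin n → ℝ × ℝ) (rad : Fin n → ℝ) {k : Fin n}
    (hdisj : ∀ j, j ≠ k → Disjoint (Ccir ctr rad j) (Ccir ctr rad k)) {p : ℝ × ℝ}
    (hp : p ∈ Ccir ctr rad k) : pev (muk ctr rad k) p ≠ 0 := by
  rw [pev, muk, map_prod, Finset.prod_ne_zero_iff]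
  intro j hj hj0
  exact Set.disjoint_left.1 (hdisj j (Finset.ne_of_mem_erase hj)) hj0 hp

lemma pev_Bpoly_ne_zero (r : ℕ) (ctr : Fin n → ℝ × ℝ) {p : ℝ × ℝ} (hp : ∀ j, ctr j ≠ p) :
    pev (Bpoly r ctr) p ≠ 0 := by
  rw [pev, Bpoly, map_prod, Finset.prod_ne_zero_iff]
  intro j _ hj0
  rw [← pev_eq_eval, pev_gpoly] at hj0
  exact hp j (Prod.ext (by nlinarith [sq_nonneg (p.1 - (ctr j).1), sq_nonneg (p.2 - (ctr j).2)])
    (by nlinarith [sq_nonneg (p.1 - (ctr j).1), sq_nonneg (p.2 - (ctr j).2)]))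

/-- On the circle `{f_k = 0}` one has
`P_T = −τ_k B μ_k ∂f_k/∂y` and `Q_T = τ_k B μ_k ∂f_k/∂x`; consequently the vector field
`X_T` vanishes at no point of the circle `C_k`. -/
theorem XT_on_circle
    (r : ℕ) (ctr : Fin n → ℝ × ℝ) (rad τ : Fin n → ℝ)
    (hn : 1 ≤ n) (hrn : r ≤ n) (hrad : ∀ k, 0 < rad k)
    (hdisj : ∀ j k, j ≠ k → Disjoint (Ccir ctr rad j) (Ccir ctr rad k))
    (hctr : ∀ j k, ctr j ∉ Ccir ctr rad k)
    (hprim : ∀ k, Primary ctr rad k ↔ (k : ℕ) < r)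
    (hτ : ∀ k, 0 < τ k) (k : Fin n) :
    (∀ p : ℝ × ℝ, pev (fk ctr rad k) p = 0 →
      pev (PT r ctr rad τ) p =
        -(τ k) * pev (Bpoly r ctr) p * pev (muk ctr rad k) p *
          pev (pderiv 1 (fk ctr rad k)) p ∧
      pev (QT r ctr rad τ) p =
        τ k * pev (Bpoly r ctr) p * pev (muk ctr rad k) p *
          pev (pderiv 0 (fk ctr rad k)) p) ∧
    ∀ p ∈ Ccir ctr rad k, (pev (PT r ctr rad τ) p, pev (QT r ctr rad τ) p) ≠ (0, 0) := by
  refine ⟨fun p hp => ⟨pev_PT_on_circle r ctr rad τ hp, pev_QT_on_circle r ctr rad τ hp⟩, ?_⟩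
  intro p hp h
  have hμ := pev_muk_ne_zero ctr rad (fun j => hdisj j k) hp
  have hB := pev_Bpoly_ne_zero r ctr (fun j hj => hctr j k (hj ▸ hp))
  obtain ⟨hP, hQ⟩ := Prod.mk.inj h
  rw [pev_PT_on_circle r ctr rad τ hp, pev_pderiv_one_fk] at hP
  rw [pev_QT_on_circle r ctr rad τ hp, pev_pderiv_zero_fk] at hQ
  have hx : p.1 - (ctr k).1 = 0 := by simpa [hμ, hB, (hτ k).ne'] using hQ
  have hy : p.2 - (ctr k).2 = 0 := by simpa [hμ, hB, (hτ k).ne'] using hP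
  have hc : pev (fk ctr rad k) p = 0 := hp
  rw [pev_fk, hx, hy] at hc
  nlinarith [pow_pos (hrad k) 2]
end
end

section
/- The polynomial V_m := A_m·B is an inverse integrating factor of the vector field X_m; that is, the identity P_m ∂(A_m B)/∂x + Q_m ∂(A_m B)/∂y = A_m B·(∂P_m/∂x + ∂Q_m/∂y) holds in ℝ[x,y]. Moreover, deg P_m ≤ 2(r + Σ_{k=1}^n m_k) − 1 and deg Q_m ≤ 2(r + Σ_{k=1}^n m_k) − 1. -/
open MvPolynomial Function Set Filter Real
open scoped Classical

noncomputable section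

variable {n : ℕ}

/-- `λ_k = ∏_{j≠k} f_j^{m_j}`. -/
def lamk (ctr : Fin n → ℝ × ℝ) (rad : Fin n → ℝ) (m : Fin n → ℕ) (k : Fin n) : Poly2 :=
  ∏ j ∈ Finset.univ.erase k, fk ctr rad j ^ m j

/-- `Λ = Σ_k (m_k − 1)`. -/
def Lam (m : Fin n → ℕ) : ℕ := ∑ k, (m k - 1)

/-- `A_m = ∏_k f_k^{m_k}`. -/
def Am (ctr : Fin n → ℝ × ℝ) (rad : Fin n → ℝ) (m : Fin n → ℕ) : Poly2 :=
  ∏ k, fk ctr rad k ^ m k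

/-- `P_{LR} = A(∂B/∂x − ∂B/∂y) − B Σ_k μ_k ∂f_k/∂y`. -/
def PLR (r : ℕ) (ctr : Fin n → ℝ × ℝ) (rad : Fin n → ℝ) : Poly2 :=
  Apoly ctr rad * (pderiv 0 (Bpoly r ctr) - pderiv 1 (Bpoly r ctr)) -
    Bpoly r ctr * ∑ k, muk ctr rad k * pderiv 1 (fk ctr rad k)

/-- `Q_{LR} = A(∂B/∂x + ∂B/∂y) + B Σ_k μ_k ∂f_k/∂x`. -/
def QLR (r : ℕ) (ctr : Fin n → ℝ × ℝ) (rad : Fin n → ℝ) : Poly2 :=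
  Apoly ctr rad * (pderiv 0 (Bpoly r ctr) + pderiv 1 (Bpoly r ctr)) +
    Bpoly r ctr * ∑ k, muk ctr rad k * pderiv 0 (fk ctr rad k)

/-- `F = Λ Σ_k λ_k ∂f_k/∂y`. -/
def Fm (ctr : Fin n → ℝ × ℝ) (rad : Fin n → ℝ) (m : Fin n → ℕ) : Poly2 :=
  MvPolynomial.C ((Lam m : ℕ) : ℝ) * ∑ k, lamk ctr rad m k * pderiv 1 (fk ctr rad k)

/-- `G = Λ Σ_k λ_k ∂f_k/∂x`. -/
def Gm (ctr : Fin n → ℝ × ℝ) (rad : Fin n → ℝ) (m : Fin n → ℕ) : Poly2 :=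
  MvPolynomial.C ((Lam m : ℕ) : ℝ) * ∑ k, lamk ctr rad m k * pderiv 0 (fk ctr rad k)

/-- `P_m = P_{LR} · ∏_k f_k^{m_k−1} − B F`. -/
def Pm (r : ℕ) (ctr : Fin n → ℝ × ℝ) (rad : Fin n → ℝ) (m : Fin n → ℕ) : Poly2 :=
  PLR r ctr rad * ∏ k, fk ctr rad k ^ (m k - 1) - Bpoly r ctr * Fm ctr rad m

/-- `Q_m = Q_{LR} · ∏_k f_k^{m_k−1} + B G`. -/
def Qm (r : ℕ) (ctr : Fin n → ℝ × ℝ) (rad : Fin n → ℝ) (m : Fin n → ℕ) : Poly2 :=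
  QLR r ctr rad * ∏ k, fk ctr rad k ^ (m k - 1) + Bpoly r ctr * Gm ctr rad m

theorem pderiv_pderiv_comm {σ R : Type*} [CommRing R] (i j : σ) (p : MvPolynomial σ R) :
    pderiv i (pderiv j p) = pderiv j (pderiv i p) := by
  have h : ⁅pderiv (R := R) i, pderiv (R := R) j⁆ = 0 := by
    refine MvPolynomial.derivation_ext fun k => ?_
    rw [Derivation.commutator_apply]
    by_cases hi : k = i <;> by_cases hj : k = j <;>
      simp [pderiv_X, Pi.single_apply, hi, hj, apply_ite]
  have h' := congrArg (fun D => D p) h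
  simpa [Derivation.commutator_apply, sub_eq_zero] using h'

theorem totalDegree_pderiv_le {σ R : Type*} [CommSemiring R] (i : σ) (p : MvPolynomial σ R) :
    (pderiv i p).totalDegree ≤ p.totalDegree - 1 := by
  conv_lhs => rw [p.as_sum, map_sum]
  refine totalDegree_finsetSum_le fun s hs => ?_
  rw [pderiv_monomial]
  by_cases hsi : s i = 0
  · simp [hsi]
  refine (totalDegree_monomial_le _ _).trans ?_
  have hle : Finsupp.single i 1 ≤ s := by
    simpa [Finsupp.single_le_iff] using Nat.one_le_iff_ne_zero.mpr hsi
  have hdeg := le_totalDegree hs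
  have hsplit : (s.sum fun _ e => e) =
      ((s - Finsupp.single i 1).sum fun _ e => e) + 1 := by
    conv_lhs => rw [← tsub_add_cancel_of_le hle]
    rw [Finsupp.sum_add_index' (by simp) (by simp)]
    simp
  change ((s - Finsupp.single i 1).sum fun _ e => e) ≤ _
  omega

theorem totalDegree_mul_le_of_le {σ R : Type*} [CommSemiring R] {p q : MvPolynomial σ R}
    {a b : ℕ} (hp : p.totalDegree ≤ a) (hq : q.totalDegree ≤ b) :
    (p * q).totalDegree ≤ a + b :=
  (totalDegree_mul p q).trans (add_le_add hp hq)

theorem totalDegree_mul_pderiv_le {σ R : Type*} [CommSemiring R] {p q : MvPolynomial σ R}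
    {a b : ℕ} (i : σ) (hp : p.totalDegree ≤ a) (hq : q.totalDegree ≤ b) :
    (p * pderiv i q).totalDegree ≤ a + b - 1 := by
  rcases Nat.eq_zero_or_pos q.totalDegree with h | h
  · rw [totalDegree_eq_zero_iff_eq_C.mp h]
    simp
  · have := totalDegree_mul_le_of_le hp (totalDegree_pderiv_le i q)
    omega

theorem totalDegree_add_le_of_le {σ R : Type*} [CommSemiring R] {p q : MvPolynomial σ R}
    {d : ℕ} (hp : p.totalDegree ≤ d) (hq : q.totalDegree ≤ d) : (p + q).totalDegree ≤ d :=
  (totalDegree_add p q).trans (max_le hp hq)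

theorem totalDegree_sub_le_of_le {σ R : Type*} [CommRing R] {p q : MvPolynomial σ R}
    {d : ℕ} (hp : p.totalDegree ≤ d) (hq : q.totalDegree ≤ d) : (p - q).totalDegree ≤ d :=
  (totalDegree_sub p q).trans (max_le hp hq)

theorem totalDegree_gpoly_le (c : ℝ × ℝ) : (gpoly c).totalDegree ≤ 2 := by
  have h (i : Fin 2) (a : ℝ) : ((X i - C a : Poly2) ^ 2).totalDegree ≤ 2 := by
    have h1 : (X i - C a : Poly2).totalDegree ≤ 1 :=
      totalDegree_sub_le_of_le (by simp) (by simp)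
    have h2 := totalDegree_pow (X i - C a : Poly2) 2
    omega
  exact totalDegree_add_le_of_le (h _ _) (h _ _)

theorem totalDegree_fpoly_le (c : ℝ × ℝ) (ρ : ℝ) : (fpoly c ρ).totalDegree ≤ 2 :=
  totalDegree_sub_le_of_le (totalDegree_gpoly_le c) (by rw [totalDegree_C]; omega)

theorem totalDegree_prod_fk_pow_le (ctr : Fin n → ℝ × ℝ) (rad : Fin n → ℝ) (e : Fin n → ℕ)
    (s : Finset (Fin n)) :
    (∏ k ∈ s, fk ctr rad k ^ e k).totalDegree ≤ 2 * ∑ k ∈ s, e k := by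
  rw [Finset.mul_sum]
  refine (totalDegree_finsetProd _ _).trans (Finset.sum_le_sum fun k _ => ?_)
  refine (totalDegree_pow _ _).trans ?_
  rw [mul_comm]
  exact Nat.mul_le_mul_right _ (totalDegree_fpoly_le _ _)

theorem totalDegree_Bpoly_le (r : ℕ) (ctr : Fin n → ℝ × ℝ) :
    (Bpoly r ctr).totalDegree ≤ 2 * r := by
  refine (totalDegree_finsetProd _ _).trans ?_
  refine (Finset.sum_le_card_nsmul _ _ 2 fun k _ => totalDegree_gpoly_le _).trans ?_
  have hcard : (Finset.univ.filter fun k : Fin n => (k : ℕ) < r).card ≤ r := by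
    rw [Fin.card_filter_val_lt]
    exact min_le_right _ _
  rw [smul_eq_mul]
  omega

/-- `q * Δq = |∇q|²`, which says that `log q` is harmonic where `q` is positive. -/
def IsLogHarmonic (q : Poly2) : Prop :=
  q * (pderiv 0 (pderiv 0 q) + pderiv 1 (pderiv 1 q)) = pderiv 0 q ^ 2 + pderiv 1 q ^ 2

theorem IsLogHarmonic.mul {p q : Poly2} (hp : IsLogHarmonic p) (hq : IsLogHarmonic q) :
    IsLogHarmonic (p * q) := by
  unfold IsLogHarmonic at *
  simp only [pderiv_mul, map_add]
  linear_combination q ^ 2 * hp + p ^ 2 * hq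

theorem isLogHarmonic_gpoly (c : ℝ × ℝ) : IsLogHarmonic (gpoly c) := by
  simp only [IsLogHarmonic, gpoly, pderiv_mul, map_add, map_sub, pow_two, pderiv_C, pderiv_X,
    Pi.single_apply]
  simp
  ring

theorem isLogHarmonic_Bpoly (r : ℕ) (ctr : Fin n → ℝ × ℝ) : IsLogHarmonic (Bpoly r ctr) :=
  Finset.prod_induction _ IsLogHarmonic (fun _ _ => IsLogHarmonic.mul)
    (by simp [IsLogHarmonic]) fun _ _ => isLogHarmonic_gpoly _

theorem IsInvFactor.add {P Q P' Q' V : Poly2} (h : IsInvFactor P Q V)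
    (h' : IsInvFactor P' Q' V) : IsInvFactor (P + P') (Q + Q') V := by
  unfold IsInvFactor divPoly at *
  simp only [map_add]
  linear_combination h + h'

theorem IsInvFactor.C_mul {P Q V : Poly2} (a : ℝ) (h : IsInvFactor P Q V) :
    IsInvFactor (C a * P) (C a * Q) V := by
  unfold IsInvFactor divPoly at *
  simp only [pderiv_C_mul]
  linear_combination C a * h

theorem IsInvFactor.sum {ι : Type*} (s : Finset ι) {P Q : ι → Poly2} {V : Poly2}
    (h : ∀ i ∈ s, IsInvFactor (P i) (Q i) V) :
    IsInvFactor (∑ i ∈ s, P i) (∑ i ∈ s, Q i) V := by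
  unfold IsInvFactor divPoly at *
  simp only [map_sum, Finset.sum_mul, ← Finset.sum_add_distrib, Finset.mul_sum]
  refine Finset.sum_congr rfl fun i hi => ?_
  rw [h i hi]

theorem IsLogHarmonic.isInvFactor_gradient {q : Poly2} (hq : IsLogHarmonic q) (u : Poly2) :
    IsInvFactor (u * pderiv 0 q) (u * pderiv 1 q) (u * q) := by
  unfold IsInvFactor divPoly IsLogHarmonic at *
  simp only [pderiv_mul]
  linear_combination -u ^ 2 * hq

theorem isInvFactor_hamiltonian (u f : Poly2) (e : ℕ) :
    IsInvFactor (-(u * pderiv 1 f)) (u * pderiv 0 f) (u * f ^ e) := by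
  unfold IsInvFactor divPoly
  simp only [pderiv_mul, pderiv_pow, map_neg, pderiv_pderiv_comm 1 0 f]
  ring

/-- `V_m = A_m·B` is a polynomial inverse integrating factor of `X_m`, and
the components `P_m, Q_m` have degree at most `2(r + Σ m_k) − 1`. -/
theorem inverse_integrating_factor_Xm
    (r : ℕ) (ctr : Fin n → ℝ × ℝ) (rad : Fin n → ℝ) (m : Fin n → ℕ)
    (hn : 1 ≤ n) (hrn : r ≤ n) (hrad : ∀ k, 0 < rad k)
    (hdisj : ∀ j k, j ≠ k → Disjoint (Ccir ctr rad j) (Ccir ctr rad k))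
    (hctr : ∀ j k, ctr j ∉ Ccir ctr rad k)
    (hprim : ∀ k, Primary ctr rad k ↔ (k : ℕ) < r)
    (hm : ∀ k, 1 ≤ m k) :
    IsInvFactor (Pm r ctr rad m) (Qm r ctr rad m) (Am ctr rad m * Bpoly r ctr) ∧
    (Pm r ctr rad m).totalDegree ≤ 2 * (r + ∑ k, m k) - 1 ∧
    (Qm r ctr rad m).totalDegree ≤ 2 * (r + ∑ k, m k) - 1 := by
  set A := Apoly ctr rad with hA
  set B := Bpoly r ctr with hB
  set W := ∏ k, fk ctr rad k ^ (m k - 1) with hW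
  have hAW : A * W = Am ctr rad m := by
    rw [hA, hW, Apoly, Am, ← Finset.prod_mul_distrib]
    exact Finset.prod_congr rfl fun k _ => mul_pow_sub_one (by have := hm k; omega) _
  have hmu (k : Fin n) : muk ctr rad k * fk ctr rad k = A :=
    Finset.prod_erase_mul _ _ (Finset.mem_univ k)
  have hlam (k : Fin n) : lamk ctr rad m k * fk ctr rad k ^ m k = Am ctr rad m :=
    Finset.prod_erase_mul _ (fun k => fk ctr rad k ^ m k) (Finset.mem_univ k)
  have hWdeg : W.totalDegree ≤ 2 * ∑ k, (m k - 1) := totalDegree_prod_fk_pow_le ctr rad _ _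
  have hBdeg : B.totalDegree ≤ 2 * r := totalDegree_Bpoly_le r ctr
  have hsum : ∑ k, (m k - 1) + n = ∑ k, m k := by
    have : ∑ k, (m k - 1 + 1) = ∑ k, m k :=
      Finset.sum_congr rfl fun k _ => Nat.sub_add_cancel (hm k)
    simpa [Finset.sum_add_distrib] using this
  have hAdeg : A.totalDegree ≤ 2 * n := by
    simpa [hA, Apoly] using totalDegree_prod_fk_pow_le ctr rad (fun _ => 1) Finset.univ
  have hBder (i : Fin 2) : (A * W * pderiv i B).totalDegree ≤ 2 * (r + ∑ k, m k) - 1 := by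
    have := totalDegree_mul_pderiv_le i (totalDegree_mul_le_of_le hAdeg hWdeg) hBdeg
    omega
  have hmuder (i : Fin 2) (k : Fin n) :
      (B * W * muk ctr rad k * pderiv i (fk ctr rad k)).totalDegree ≤
        2 * (r + ∑ k, m k) - 1 := by
    have h1 : (muk ctr rad k).totalDegree ≤ 2 * (n - 1) := by
      simpa [muk] using totalDegree_prod_fk_pow_le ctr rad (fun _ => 1) (Finset.univ.erase k)
    have := totalDegree_mul_pderiv_le i
      (totalDegree_mul_le_of_le (totalDegree_mul_le_of_le hBdeg hWdeg) h1)
      (totalDegree_fpoly_le (ctr k) (rad k))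
    change (_ * pderiv i (fpoly (ctr k) (rad k))).totalDegree ≤ _
    omega
  have hlamder (i : Fin 2) (k : Fin n) :
      (B * lamk ctr rad m k * pderiv i (fk ctr rad k)).totalDegree ≤
        2 * (r + ∑ k, m k) - 1 := by
    have h1 : (lamk ctr rad m k).totalDegree ≤ 2 * ∑ j ∈ Finset.univ.erase k, m j :=
      totalDegree_prod_fk_pow_le ctr rad m _
    have h2 : ∑ j ∈ Finset.univ.erase k, m j + m k = ∑ j, m j :=
      Finset.sum_erase_add _ _ (Finset.mem_univ k)
    have := totalDegree_mul_pderiv_le i (totalDegree_mul_le_of_le hBdeg h1)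
      (totalDegree_fpoly_le (ctr k) (rad k))
    have := hm k
    change (_ * pderiv i (fpoly (ctr k) (rad k))).totalDegree ≤ _
    omega
  have hCsum (i : Fin 2) : (C ((Lam m : ℕ) : ℝ) *
      ∑ k, B * lamk ctr rad m k * pderiv i (fk ctr rad k)).totalDegree ≤
        2 * (r + ∑ k, m k) - 1 := by
    have := totalDegree_mul_le_of_le (totalDegree_C ((Lam m : ℕ) : ℝ)).le
      (totalDegree_finsetSum_le fun k (_ : k ∈ Finset.univ) => hlamder i k)
    simpa using this
  have hP : Pm r ctr rad m = A * W * pderiv 0 B - A * W * pderiv 1 B -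
      ∑ k, B * W * muk ctr rad k * pderiv 1 (fk ctr rad k) -
      C ((Lam m : ℕ) : ℝ) * ∑ k, B * lamk ctr rad m k * pderiv 1 (fk ctr rad k) := by
    simp only [Pm, PLR, Fm, ← hA, ← hB, ← hW, mul_assoc, ← Finset.mul_sum]
    ring
  have hQ : Qm r ctr rad m = A * W * pderiv 0 B + A * W * pderiv 1 B +
      ∑ k, B * W * muk ctr rad k * pderiv 0 (fk ctr rad k) +
      C ((Lam m : ℕ) : ℝ) * ∑ k, B * lamk ctr rad m k * pderiv 0 (fk ctr rad k) := by
    simp only [Qm, QLR, Gm, ← hA, ← hB, ← hW, mul_assoc, ← Finset.mul_sum]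
    ring
  refine ⟨?_, ?_, ?_⟩
  · have hgrad : IsInvFactor (A * W * pderiv 0 B) (A * W * pderiv 1 B) (A * W * B) :=
      (isLogHarmonic_Bpoly r ctr).isInvFactor_gradient _
    have hham : IsInvFactor (-(A * W * pderiv 1 B)) (A * W * pderiv 0 B) (A * W * B) := by
      simpa using isInvFactor_hamiltonian (A * W) B 1
    have hmuham : IsInvFactor (∑ k, -(B * W * muk ctr rad k * pderiv 1 (fk ctr rad k)))
        (∑ k, B * W * muk ctr rad k * pderiv 0 (fk ctr rad k)) (A * W * B) := by
      refine IsInvFactor.sum _ fun k _ => ?_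
      convert isInvFactor_hamiltonian (B * W * muk ctr rad k) (fk ctr rad k) 1 using 1
      rw [← hmu k]
      ring
    have hlamham : IsInvFactor (∑ k, -(B * lamk ctr rad m k * pderiv 1 (fk ctr rad k)))
        (∑ k, B * lamk ctr rad m k * pderiv 0 (fk ctr rad k)) (A * W * B) := by
      refine IsInvFactor.sum _ fun k _ => ?_
      convert isInvFactor_hamiltonian (B * lamk ctr rad m k) (fk ctr rad k) (m k) using 1
      rw [hAW, ← hlam k]
      ring
    rw [hP, hQ, ← hAW]
    convert ((hgrad.add hham).add hmuham).add (hlamham.C_mul ((Lam m : ℕ) : ℝ)) using 1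
    · simp only [Finset.sum_neg_distrib]
      ring
    · ring
  · rw [hP]
    exact totalDegree_sub_le_of_le (totalDegree_sub_le_of_le
      (totalDegree_sub_le_of_le (hBder 0) (hBder 1))
      (totalDegree_finsetSum_le fun k _ => hmuder 1 k)) (hCsum 1)
  · rw [hQ]
    exact totalDegree_add_le_of_le (totalDegree_add_le_of_le
      (totalDegree_add_le_of_le (hBder 0) (hBder 1))
      (totalDegree_finsetSum_le fun k _ => hmuder 0 k)) (hCsum 0)
end
end
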